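/- Let (X,S) be an association scheme of order n and H a Hadamard matrix of order n whose rows and columns are indexed by X. Define on X̃ = X × F₂ × F₂ the relations: 1_{X̃}; t̃ = {((x,a,b),(x,a,b+1))}; s̃ = {((x,a,b),(y,a,c)) : (x,y) ∈ s} for each s ∈ S∖{1_X}; r¹_H = {((x,a,b),(y,c,d)) : a ≠ c and (H^{T(a)})_{x,y} = (−1)^{b+d}}; and r⁻¹_H = {((x,a,b),(y,c,d)) : a ≠ c} ∖ r¹_H, where H^{T(0)} = H and H^{T(1)} = Hᵀ. Then the collection S(H) = {1_{X̃}, t̃} ∪ {s̃ : s ∈ S∖{1_X}} ∪ {r¹_H, r⁻¹_H} is a partition of X̃ × X̃ forming an association scheme on X̃. -/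

import Mathlib

/-- `(-1)^e` for `e ∈ F₂`. -/
def sgn (e : ZMod 2) : ℝ := if e = 0 then 1 else -1

/-- `H^{T(a)}`: the matrix `H` if `a = 0`, its transpose if `a = 1`. -/
def Ht {X : Type*} (H : Matrix X X ℝ) (a : ZMod 2) : Matrix X X ℝ :=
  if a = 0 then H else H.transpose

/-- A Hadamard matrix indexed by a finite set `X`. -/
def IsHadamard {X : Type*} [Fintype X] [DecidableEq X] (H : Matrix X X ℝ) : Prop :=
  (∀ i j, H i j = 1 ∨ H i j = -1) ∧ H * H.transpose = (Fintype.card X : ℝ) • 1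

/-- The defining conditions for a family of relations on `Y` to be an association
scheme: a partition of `Y × Y` containing the identity, closed under converse,
with constant intersection numbers. -/
def IsAssocScheme {Y : Type*} (S : Set (Set (Y × Y))) : Prop :=
  (∀ p : Y × Y, ∃! s, s ∈ S ∧ p ∈ s) ∧
  {p : Y × Y | p.1 = p.2} ∈ S ∧
  (∀ s ∈ S, {p : Y × Y | Prod.swap p ∈ s} ∈ S) ∧
  (∀ s ∈ S, ∀ t ∈ S, ∀ u ∈ S, ∀ p ∈ u, ∀ q ∈ u,
    Set.ncard {z : Y | (Prod.fst p, z) ∈ s ∧ (z, Prod.snd p) ∈ t} =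
      Set.ncard {z : Y | (Prod.fst q, z) ∈ s ∧ (z, Prod.snd q) ∈ t})

/-- The lift `s̃` of a relation `s` on `X` to `X × F₂ × F₂`. -/
def liftRel {X : Type*} (s : Set (X × X)) :
    Set ((X × ZMod 2 × ZMod 2) × (X × ZMod 2 × ZMod 2)) :=
  {p | p.1.2.1 = p.2.2.1 ∧ (p.1.1, p.2.1) ∈ s}

/-- The relation `t̃ = {((x,a,b),(x,a,b+1))}`. -/
def tRel (X : Type*) : Set ((X × ZMod 2 × ZMod 2) × (X × ZMod 2 × ZMod 2)) :=
  {p | p.1.1 = p.2.1 ∧ p.1.2.1 = p.2.2.1 ∧ p.2.2.2 = p.1.2.2 + 1}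

/-- The relation `r¹_H`. -/
def rOne {X : Type*} (H : Matrix X X ℝ) :
    Set ((X × ZMod 2 × ZMod 2) × (X × ZMod 2 × ZMod 2)) :=
  {p | p.1.2.1 ≠ p.2.2.1 ∧ Ht H p.1.2.1 p.1.1 p.2.1 = sgn (p.1.2.2 + p.2.2.2)}

/-- The relation `r⁻¹_H`. -/
def rNegOne {X : Type*} (H : Matrix X X ℝ) :
    Set ((X × ZMod 2 × ZMod 2) × (X × ZMod 2 × ZMod 2)) :=
  {p : (X × ZMod 2 × ZMod 2) × (X × ZMod 2 × ZMod 2) | p.1.2.1 ≠ p.2.2.1} \ rOne H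

/-- The family `S(H)` of relations on `X̃ = X × F₂ × F₂`. -/
def SH {X : Type*} (S : Set (Set (X × X))) (H : Matrix X X ℝ) :
    Set (Set ((X × ZMod 2 × ZMod 2) × (X × ZMod 2 × ZMod 2))) :=
  {{p | p.1 = p.2}, tRel X} ∪
    (liftRel '' (S \ {{p : X × X | p.1 = p.2}})) ∪ {rOne H, rNegOne H}

theorem ZMod.two_cases (e : ZMod 2) : e = 0 ∨ e = 1 := by
  revert e; decide

theorem ZMod.two_add_self (e : ZMod 2) : e + e = 0 := by
  revert e; decide

theorem ZMod.two_eq_of_ne {a b c : ZMod 2} (hab : a ≠ b) (hcb : c ≠ b) : a = c := by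
  revert a b c; decide

theorem ZMod.two_add_one_ne (a : ZMod 2) : a + 1 ≠ a := by
  revert a; decide

theorem sgn_injective : Function.Injective sgn := by
  intro a b h
  rcases ZMod.two_cases a with rfl | rfl <;> rcases ZMod.two_cases b with rfl | rfl <;>
    first | rfl | (norm_num [sgn] at h)

theorem sgn_add (a b : ZMod 2) : sgn (a + b) = sgn a * sgn b := by
  have h : (1 + 1 : ZMod 2) = 0 := by decide
  rcases ZMod.two_cases a with rfl | rfl <;> rcases ZMod.two_cases b with rfl | rfl <;>
    simp [sgn, h]

theorem sum_sgn_eq {X : Type*} [Fintype X] (f : X → ZMod 2) :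
    ∑ z, sgn (f z) = ({z | f z = 0}.ncard : ℝ) - {z | f z = 1}.ncard := by
  classical
  have h (z : X) : sgn (f z) = (if f z = 0 then 1 else 0) - (if f z = 1 then 1 else 0) := by
    rcases ZMod.two_cases (f z) with h | h <;> norm_num [sgn, h]
  simp only [h, Finset.sum_sub_distrib, Finset.sum_boole, Set.ncard_eq_toFinset_card',
    Set.toFinset_ofPred]

/-- The exponents of the entries of `H^{T(a)}`. -/
noncomputable def signExp {X : Type*} (H : Matrix X X ℝ) (a : ZMod 2) (x y : X) : ZMod 2 :=
  open Classical in if Ht H a x y = 1 then 0 else 1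

theorem Ht_swap {X : Type*} (H : Matrix X X ℝ) {a c : ZMod 2} (h : a ≠ c) (x y : X) :
    Ht H a x y = Ht H c y x := by
  rcases ZMod.two_cases a with rfl | rfl <;> rcases ZMod.two_cases c with rfl | rfl <;>
    simp_all [Ht]

theorem signExp_swap {X : Type*} (H : Matrix X X ℝ) {a c : ZMod 2} (h : a ≠ c) (x y : X) :
    signExp H a x y = signExp H c y x := by
  simp only [signExp, Ht_swap H h]

section Hadamard

variable {X : Type*} [Fintype X] [DecidableEq X] {H : Matrix X X ℝ}

theorem IsHadamard.Ht_eq_sgn (hH : IsHadamard H) (a : ZMod 2) (x y : X) :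
    Ht H a x y = sgn (signExp H a x y) := by
  have h : Ht H a x y = 1 ∨ Ht H a x y = -1 := by
    unfold Ht
    split_ifs
    exacts [hH.1 x y, hH.1 y x]
  rcases h with h | h <;> norm_num [signExp, sgn, h]

theorem IsHadamard.transpose_mul (hH : IsHadamard H) :
    H.transpose * H = (Fintype.card X : ℝ) • 1 := by
  rcases isEmpty_or_nonempty X with hX | hX
  · ext i
    exact hX.elim i
  have hn : (Fintype.card X : ℝ) ≠ 0 := by exact_mod_cast Fintype.card_ne_zero
  have h : H * ((Fintype.card X : ℝ)⁻¹ • H.transpose) = 1 := by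
    rw [Matrix.mul_smul, hH.2, smul_smul, inv_mul_cancel₀ hn, one_smul]
  have h' := mul_eq_one_comm.mp h
  rw [Matrix.smul_mul] at h'
  rw [← h', smul_smul, mul_inv_cancel₀ hn, one_smul]

theorem IsHadamard.Ht_mul_transpose (hH : IsHadamard H) (a : ZMod 2) :
    Ht H a * (Ht H a).transpose = (Fintype.card X : ℝ) • 1 := by
  unfold Ht
  split_ifs
  · exact hH.2
  · simpa using hH.transpose_mul

/-- Two distinct rows of `H^{T(a)}` agree as often as they disagree. -/
theorem IsHadamard.ncard_signExp_add (hH : IsHadamard H) (a : ZMod 2) {x y : X} (hxy : x ≠ y)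
    (ε : ZMod 2) :
    {z | signExp H a x z + signExp H a y z = ε}.ncard =
      {z | signExp H a x z + signExp H a y z = 0}.ncard := by
  have h := congrFun (congrFun (hH.Ht_mul_transpose a) x) y
  simp only [Matrix.mul_apply, Matrix.transpose_apply, hH.Ht_eq_sgn, ← sgn_add, sum_sgn_eq,
    Matrix.smul_apply, Matrix.one_apply_ne hxy, smul_zero, sub_eq_zero, Nat.cast_inj] at h
  rcases ZMod.two_cases ε with rfl | rfl
  exacts [rfl, h.symm]

/-- Any two distinct rows of `H` or `Hᵀ` disagree in half of the positions. -/
theorem IsHadamard.two_mul_ncard_signExp_add (hH : IsHadamard H) (a : ZMod 2) {x y : X}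
    (hxy : x ≠ y) (ε : ZMod 2) :
    2 * {z | signExp H a x z + signExp H a y z = ε}.ncard = Fintype.card X := by
  have h : {z | signExp H a x z + signExp H a y z = 0}ᶜ =
      {z | signExp H a x z + signExp H a y z = 1} := by
    ext z
    rcases ZMod.two_cases (signExp H a x z + signExp H a y z) with h | h <;> simp [h]
  have h' := Set.ncard_add_ncard_compl {z | signExp H a x z + signExp H a y z = 0}
  rw [h, hH.ncard_signExp_add a hxy 1, Nat.card_eq_fintype_card] at h'
  rw [hH.ncard_signExp_add a hxy ε]
  lia

end Hadamard

/-- The relation `{((x,a,b),(x,a,b+δ))}`. -/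
def diagRel (X : Type*) (δ : ZMod 2) : Set ((X × ZMod 2 × ZMod 2) × (X × ZMod 2 × ZMod 2)) :=
  {p | p.1.1 = p.2.1 ∧ p.1.2.1 = p.2.2.1 ∧ p.2.2.2 = p.1.2.2 + δ}

/-- The relation `r^{(-1)^δ}_H`. -/
def signRel {X : Type*} (H : Matrix X X ℝ) (δ : ZMod 2) :
    Set ((X × ZMod 2 × ZMod 2) × (X × ZMod 2 × ZMod 2)) :=
  {p | p.1.2.1 ≠ p.2.2.1 ∧ signExp H p.1.2.1 p.1.1 p.2.1 = p.1.2.2 + p.2.2.2 + δ}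

/-- Translation of the last coordinate. -/
def shift {X : Type*} (δ : ZMod 2) (v : X × ZMod 2 × ZMod 2) : X × ZMod 2 × ZMod 2 :=
  (v.1, v.2.1, v.2.2 + δ)

section Relations

variable {X : Type*}

theorem diagRel_zero : diagRel X 0 = {p | p.1 = p.2} := by
  ext ⟨⟨x, a, b⟩, ⟨y, c, d⟩⟩
  simp [diagRel, eq_comm]

theorem diagRel_one : diagRel X 1 = tRel X := rfl

theorem mem_diagRel_iff {δ : ZMod 2} {v w : X × ZMod 2 × ZMod 2} :
    (v, w) ∈ diagRel X δ ↔ w = shift δ v := by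
  obtain ⟨x, a, b⟩ := v
  obtain ⟨y, c, d⟩ := w
  simp [diagRel, shift, eq_comm]

theorem mem_diagRel_iff' {δ : ZMod 2} {v w : X × ZMod 2 × ZMod 2} :
    (v, w) ∈ diagRel X δ ↔ v = shift δ w := by
  obtain ⟨x, a, b⟩ := v
  obtain ⟨y, c, d⟩ := w
  have h : d = b + δ ↔ b = d + δ := by revert b d δ; decide
  simp [diagRel, shift, h]

theorem mem_signRel_swap {H : Matrix X X ℝ} {δ : ZMod 2}
    (p : (X × ZMod 2 × ZMod 2) × (X × ZMod 2 × ZMod 2)) :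
    p.swap ∈ signRel H δ ↔ p ∈ signRel H δ := by
  obtain ⟨⟨x, a, b⟩, ⟨y, c, d⟩⟩ := p
  simp only [signRel, Prod.swap_prod_mk, Set.mem_ofPred_eq, ne_comm (a := c), add_comm d b]
  exact and_congr_right fun h => by rw [signExp_swap H h]

variable [Fintype X] [DecidableEq X] {H : Matrix X X ℝ}

theorem IsHadamard.signRel_zero (hH : IsHadamard H) : signRel H 0 = rOne H := by
  ext p
  simp [signRel, rOne, hH.Ht_eq_sgn, sgn_injective.eq_iff]

theorem IsHadamard.signRel_one (hH : IsHadamard H) : signRel H 1 = rNegOne H := by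
  ext p
  have h (e f : ZMod 2) : e = f + 1 ↔ e ≠ f := by revert e f; decide
  simp +contextual [signRel, rNegOne, rOne, hH.Ht_eq_sgn, sgn_injective.eq_iff, h]

theorem IsHadamard.mem_SH_iff (hH : IsHadamard H) {S : Set (Set (X × X))}
    {u : Set ((X × ZMod 2 × ZMod 2) × (X × ZMod 2 × ZMod 2))} :
    u ∈ SH S H ↔ (∃ δ, u = diagRel X δ) ∨
      (∃ s ∈ S, s ≠ {p : X × X | p.1 = p.2} ∧ u = liftRel s) ∨ ∃ δ, u = signRel H δ := by
  have h (P : ZMod 2 → Prop) : (∃ δ, P δ) ↔ P 0 ∨ P 1 := by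
    refine ⟨?_, fun h => h.elim (⟨_, ·⟩) (⟨_, ·⟩)⟩
    rintro ⟨δ, hδ⟩
    rcases ZMod.two_cases δ with rfl | rfl
    exacts [.inl hδ, .inr hδ]
  simp only [SH, h, diagRel_zero, diagRel_one, hH.signRel_zero, hH.signRel_one, Set.mem_union,
    Set.mem_insert_iff, Set.mem_singleton_iff, Set.mem_image, Set.mem_sdiff, or_assoc, and_assoc,
    eq_comm (a := u)]

end Relations

section Scheme

variable {X : Type*} {S : Set (Set (X × X))}

theorem IsAssocScheme.eq_of_mem {Y : Type*} {S : Set (Set (Y × Y))}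
    (h : ∀ p : Y × Y, ∃! s, s ∈ S ∧ p ∈ s) {s t : Set (Y × Y)} (hs : s ∈ S) (ht : t ∈ S)
    {p : Y × Y} (hps : p ∈ s) (hpt : p ∈ t) : s = t :=
  (h p).unique ⟨hs, hps⟩ ⟨ht, hpt⟩

theorem IsAssocScheme.mem_iff_mem {Y : Type*} {S : Set (Set (Y × Y))}
    (h : ∀ p : Y × Y, ∃! s, s ∈ S ∧ p ∈ s) {s u : Set (Y × Y)} (hs : s ∈ S) (hu : u ∈ S)
    {p q : Y × Y} (hp : p ∈ u) (hq : q ∈ u) : p ∈ s ↔ q ∈ s :=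
  ⟨fun hps => eq_of_mem h hu hs hp hps ▸ hq, fun hqs => eq_of_mem h hu hs hq hqs ▸ hp⟩

theorem IsAssocScheme.ne_of_mem (hS : IsAssocScheme S) {s : Set (X × X)} (hs : s ∈ S)
    (hs1 : s ≠ {p : X × X | p.1 = p.2}) {x y : X} (h : (x, y) ∈ s) : x ≠ y :=
  fun hxy => hs1 (eq_of_mem hS.1 hs hS.2.1 h hxy)

/-- The valency of a relation does not depend on the point. -/
theorem IsAssocScheme.ncard_right (hS : IsAssocScheme S) {s : Set (X × X)} (hs : s ∈ S)
    (x y : X) : {z | (x, z) ∈ s}.ncard = {z | (y, z) ∈ s}.ncard := by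
  simpa using hS.2.2.2 s hs _ (hS.2.2.1 s hs) _ hS.2.1 (x, x) rfl (y, y) rfl

theorem IsAssocScheme.ncard_left (hS : IsAssocScheme S) {s : Set (X × X)} (hs : s ∈ S)
    (x y : X) : {z | (z, x) ∈ s}.ncard = {z | (z, y) ∈ s}.ncard :=
  hS.ncard_right (hS.2.2.1 s hs) x y

variable [Fintype X] [DecidableEq X] {H : Matrix X X ℝ}

theorem IsHadamard.existsUnique_mem_SH (hH : IsHadamard H) (hS : IsAssocScheme S)
    (p : (X × ZMod 2 × ZMod 2) × (X × ZMod 2 × ZMod 2)) : ∃! s, s ∈ SH S H ∧ p ∈ s := by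
  obtain ⟨⟨x, a, b⟩, ⟨y, c, d⟩⟩ := p
  have e1 (b d δ : ZMod 2) : d = b + δ ↔ δ = b + d := by revert b d δ; decide
  have e2 (e b d δ : ZMod 2) : e = b + d + δ ↔ δ = e + b + d := by revert e b d δ; decide
  simp only [hH.mem_SH_iff]
  by_cases hac : a = c
  · by_cases hxy : x = y
    · refine ⟨diagRel X (b + d), ⟨.inl ⟨_, rfl⟩, hxy, hac, (e1 _ _ _).2 rfl⟩, ?_⟩
      rintro _ ⟨⟨δ, rfl⟩ | ⟨s, hs, hs1, rfl⟩ | ⟨δ, rfl⟩, hp⟩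
      · rw [(e1 _ _ _).1 hp.2.2]
      · exact absurd hxy (hS.ne_of_mem hs hs1 hp.2)
      · exact absurd hac hp.1
    · obtain ⟨s, ⟨hs, hps⟩, -⟩ := hS.1 (x, y)
      refine ⟨liftRel s, ⟨.inr (.inl ⟨s, hs, ?_, rfl⟩), hac, hps⟩, ?_⟩
      · rintro rfl
        exact hxy hps
      rintro _ ⟨⟨δ, rfl⟩ | ⟨t, ht, ht1, rfl⟩ | ⟨δ, rfl⟩, hp⟩
      · exact absurd hp.1 hxy
      · rw [IsAssocScheme.eq_of_mem hS.1 hs ht hps hp.2]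
      · exact absurd hac hp.1
  · refine ⟨signRel H (signExp H a x y + b + d),
      ⟨.inr (.inr ⟨_, rfl⟩), hac, (e2 _ _ _ _).2 rfl⟩, ?_⟩
    rintro _ ⟨⟨δ, rfl⟩ | ⟨s, hs, hs1, rfl⟩ | ⟨δ, rfl⟩, hp⟩
    · exact absurd hp.2.1 hac
    · exact absurd hp.1 hac
    · rw [(e2 _ _ _ _).1 hp.2]

theorem IsHadamard.swap_mem_SH (hH : IsHadamard H) (hS : IsAssocScheme S)
    {s : Set ((X × ZMod 2 × ZMod 2) × (X × ZMod 2 × ZMod 2))} (hs : s ∈ SH S H) :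
    {p | p.swap ∈ s} ∈ SH S H := by
  rw [hH.mem_SH_iff] at hs ⊢
  rcases hs with ⟨δ, rfl⟩ | ⟨s, hs, hs1, rfl⟩ | ⟨δ, rfl⟩
  · refine .inl ⟨δ, ?_⟩
    ext ⟨v, w⟩
    exact mem_diagRel_iff'.trans mem_diagRel_iff.symm
  · refine .inr (.inl ⟨_, hS.2.2.1 s hs, fun h => hs1 ?_, ?_⟩)
    · ext ⟨x, y⟩
      simpa [eq_comm] using Set.ext_iff.1 h (y, x)
    · ext ⟨⟨x, a, b⟩, ⟨y, c, d⟩⟩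
      simp [liftRel, eq_comm]
  · exact .inr (.inr ⟨δ, Set.ext mem_signRel_swap⟩)

/-- Translating the last coordinate of the first point permutes the relations of `S(H)`. -/
theorem IsHadamard.exists_shift_left (hH : IsHadamard H) (δ : ZMod 2)
    {u : Set ((X × ZMod 2 × ZMod 2) × (X × ZMod 2 × ZMod 2))} (hu : u ∈ SH S H) :
    ∃ u' ∈ SH S H, ∀ p ∈ u, (shift δ p.1, p.2) ∈ u' := by
  simp only [hH.mem_SH_iff] at hu ⊢
  rcases hu with ⟨γ, rfl⟩ | ⟨s, hs, hs1, rfl⟩ | ⟨γ, rfl⟩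
  · refine ⟨_, .inl ⟨γ + δ, rfl⟩, fun p hp => ⟨hp.1, hp.2.1, ?_⟩⟩
    simp only [shift, hp.2.2]
    linear_combination - ZMod.two_add_self δ
  · exact ⟨_, .inr (.inl ⟨s, hs, hs1, rfl⟩), fun p hp => hp⟩
  · refine ⟨_, .inr (.inr ⟨γ + δ, rfl⟩), fun p hp => ⟨hp.1, ?_⟩⟩
    simp only [shift, hp.2]
    linear_combination - ZMod.two_add_self δ

theorem IsHadamard.exists_shift_right (hH : IsHadamard H) (δ : ZMod 2)
    {u : Set ((X × ZMod 2 × ZMod 2) × (X × ZMod 2 × ZMod 2))} (hu : u ∈ SH S H) :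
    ∃ u' ∈ SH S H, ∀ p ∈ u, (p.1, shift δ p.2) ∈ u' := by
  simp only [hH.mem_SH_iff] at hu ⊢
  rcases hu with ⟨γ, rfl⟩ | ⟨s, hs, hs1, rfl⟩ | ⟨γ, rfl⟩
  · refine ⟨_, .inl ⟨γ + δ, rfl⟩, fun p hp => ⟨hp.1, hp.2.1, ?_⟩⟩
    simp only [shift, hp.2.2]
    ring
  · exact ⟨_, .inr (.inl ⟨s, hs, hs1, rfl⟩), fun p hp => hp⟩
  · refine ⟨_, .inr (.inr ⟨γ + δ, rfl⟩), fun p hp => ⟨hp.1, ?_⟩⟩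
    simp only [shift, hp.2]
    linear_combination - ZMod.two_add_self δ

/-- Membership in the same relation of `S(H)`, split according to the fibres. -/
theorem IsHadamard.same_fibre_cases (hH : IsHadamard H) (hS : IsAssocScheme S)
    {u : Set ((X × ZMod 2 × ZMod 2) × (X × ZMod 2 × ZMod 2))} (hu : u ∈ SH S H)
    {p q : (X × ZMod 2 × ZMod 2) × (X × ZMod 2 × ZMod 2)} (hp : p ∈ u) (hq : q ∈ u) :
    (p.1.2.1 ≠ p.2.2.1 ∧ q.1.2.1 ≠ q.2.2.1) ∨
    (p.1.2.1 = p.2.2.1 ∧ q.1.2.1 = q.2.2.1 ∧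
      (∃ s ∈ S, (p.1.1, p.2.1) ∈ s ∧ (q.1.1, q.2.1) ∈ s) ∧
      ((p.1.1 ≠ p.2.1 ∧ q.1.1 ≠ q.2.1) ∨
        (p.1.1 = p.2.1 ∧ q.1.1 = q.2.1 ∧ p.1.2.2 + p.2.2.2 = q.1.2.2 + q.2.2.2))) := by
  rw [hH.mem_SH_iff] at hu
  rcases hu with ⟨γ, rfl⟩ | ⟨s, hs, hs1, rfl⟩ | ⟨γ, rfl⟩
  · refine .inr ⟨hp.2.1, hq.2.1, ⟨_, hS.2.1, hp.1, hq.1⟩, .inr ⟨hp.1, hq.1, ?_⟩⟩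
    rw [hp.2.2, hq.2.2]
    linear_combination ZMod.two_add_self p.1.2.2 - ZMod.two_add_self q.1.2.2
  · exact .inr ⟨hp.1, hq.1, ⟨s, hs, hp.2, hq.2⟩,
      .inl ⟨hS.ne_of_mem hs hs1 hp.2, hS.ne_of_mem hs hs1 hq.2⟩⟩
  · exact .inl ⟨hp.1, hq.1⟩

end Scheme

/-- The points through which a pair of points is connected by `s` and then `t`. -/
def midpoints {Y : Type*} (s t : Set (Y × Y)) (p : Y × Y) : Set Y :=
  {z | (p.1, z) ∈ s ∧ (z, p.2) ∈ t}

section Midpoints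

variable {X : Type*}

theorem ncard_setOf_eq_and {Y : Type*} (w : Y) (P : Y → Prop) [Decidable (P w)] :
    {z | z = w ∧ P z}.ncard = if P w then 1 else 0 := by
  split_ifs with h
  · rw [show {z | z = w ∧ P z} = {w} by ext; simp +contextual [h], Set.ncard_singleton]
  · rw [show {z | z = w ∧ P z} = ∅ by ext; simp +contextual [h], Set.ncard_empty]

theorem ncard_midpoints_diagRel_left (δ : ZMod 2)
    (t : Set ((X × ZMod 2 × ZMod 2) × (X × ZMod 2 × ZMod 2)))
    (p : (X × ZMod 2 × ZMod 2) × (X × ZMod 2 × ZMod 2)) [Decidable ((shift δ p.1, p.2) ∈ t)] :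
    (midpoints (diagRel X δ) t p).ncard = if (shift δ p.1, p.2) ∈ t then 1 else 0 := by
  simp only [midpoints, mem_diagRel_iff]
  exact ncard_setOf_eq_and (shift δ p.1) fun z => (z, p.2) ∈ t

theorem ncard_midpoints_diagRel_right (δ : ZMod 2)
    (s : Set ((X × ZMod 2 × ZMod 2) × (X × ZMod 2 × ZMod 2)))
    (p : (X × ZMod 2 × ZMod 2) × (X × ZMod 2 × ZMod 2)) [Decidable ((p.1, shift δ p.2) ∈ s)] :
    (midpoints s (diagRel X δ) p).ncard = if (p.1, shift δ p.2) ∈ s then 1 else 0 := by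
  simp only [midpoints, mem_diagRel_iff', and_comm (b := _ = shift δ p.2)]
  exact ncard_setOf_eq_and (shift δ p.2) fun z => (p.1, z) ∈ s

theorem midpoints_liftRel_liftRel_of_ne (s t : Set (X × X))
    {p : (X × ZMod 2 × ZMod 2) × (X × ZMod 2 × ZMod 2)} (h : p.1.2.1 ≠ p.2.2.1) :
    midpoints (liftRel s) (liftRel t) p = ∅ :=
  Set.eq_empty_of_forall_notMem fun _ hz => h (hz.1.1.trans hz.2.1)

theorem midpoints_liftRel_signRel_of_eq (s : Set (X × X)) (H : Matrix X X ℝ) (δ : ZMod 2)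
    {p : (X × ZMod 2 × ZMod 2) × (X × ZMod 2 × ZMod 2)} (h : p.1.2.1 = p.2.2.1) :
    midpoints (liftRel s) (signRel H δ) p = ∅ :=
  Set.eq_empty_of_forall_notMem fun _ hz => hz.2.1 (hz.1.1.symm.trans h)

theorem midpoints_signRel_liftRel_of_eq (s : Set (X × X)) (H : Matrix X X ℝ) (δ : ZMod 2)
    {p : (X × ZMod 2 × ZMod 2) × (X × ZMod 2 × ZMod 2)} (h : p.1.2.1 = p.2.2.1) :
    midpoints (signRel H δ) (liftRel s) p = ∅ :=
  Set.eq_empty_of_forall_notMem fun _ hz => hz.1.1 (h.trans hz.2.1.symm)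

theorem midpoints_signRel_signRel_of_ne (H : Matrix X X ℝ) (δ ε : ZMod 2)
    {p : (X × ZMod 2 × ZMod 2) × (X × ZMod 2 × ZMod 2)} (h : p.1.2.1 ≠ p.2.2.1) :
    midpoints (signRel H δ) (signRel H ε) p = ∅ :=
  Set.eq_empty_of_forall_notMem fun _ hz => h (ZMod.two_eq_of_ne hz.1.1 hz.2.1.symm)

theorem ncard_midpoints_liftRel_liftRel (s t : Set (X × X))
    {p : (X × ZMod 2 × ZMod 2) × (X × ZMod 2 × ZMod 2)} (h : p.1.2.1 = p.2.2.1) :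
    (midpoints (liftRel s) (liftRel t) p).ncard =
      (midpoints s t (p.1.1, p.2.1)).ncard * Nat.card (ZMod 2) := by
  rw [← Set.ncard_univ, ← Set.ncard_prod,
    ← Set.ncard_image_of_injective (f := fun w : X × ZMod 2 => (w.1, p.1.2.1, w.2))
      (midpoints s t (p.1.1, p.2.1) ×ˢ Set.univ)]
  · congr 1
    ext ⟨z, c, e⟩
    simp only [midpoints, liftRel, Set.mem_ofPred_eq, Set.mem_image, Set.mem_prod, Set.mem_univ,
      Prod.exists, Prod.mk.injEq]
    constructor
    · rintro ⟨⟨rfl, h1⟩, -, h2⟩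
      exact ⟨z, e, ⟨⟨h1, h2⟩, trivial⟩, rfl, rfl, rfl⟩
    · rintro ⟨z, e, ⟨⟨h1, h2⟩, -⟩, rfl, rfl, rfl⟩
      exact ⟨⟨rfl, h1⟩, h, h2⟩
  · rintro ⟨z, e⟩ ⟨z', e'⟩ h
    simp_all

theorem ncard_graph_image (A : Set X) (c : ZMod 2) (f : X → ZMod 2) :
    {v : X × ZMod 2 × ZMod 2 | v.1 ∈ A ∧ v.2.1 = c ∧ v.2.2 = f v.1}.ncard = A.ncard := by
  rw [← Set.ncard_image_of_injective (f := fun z => (z, c, f z)) A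
    fun z z' h => congrArg Prod.fst h]
  congr 1
  ext ⟨z, c', e⟩
  simp only [Set.mem_ofPred_eq, Set.mem_image, Prod.mk.injEq]
  constructor
  · rintro ⟨hz, rfl, rfl⟩
    exact ⟨z, hz, rfl, rfl, rfl⟩
  · rintro ⟨z, hz, rfl, rfl, rfl⟩
    exact ⟨hz, rfl, rfl⟩

theorem ncard_midpoints_liftRel_signRel (s : Set (X × X)) (H : Matrix X X ℝ) (δ : ZMod 2)
    {p : (X × ZMod 2 × ZMod 2) × (X × ZMod 2 × ZMod 2)} (h : p.1.2.1 ≠ p.2.2.1) :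
    (midpoints (liftRel s) (signRel H δ) p).ncard = {z | (p.1.1, z) ∈ s}.ncard := by
  rw [← ncard_graph_image _ p.1.2.1 fun z => signExp H p.1.2.1 z p.2.1 + p.2.2.2 + δ]
  congr 1
  ext ⟨z, c, e⟩
  have h1 (f d : ZMod 2) : f = e + d + δ ↔ e = f + d + δ := by revert f d e δ; decide
  simp only [midpoints, liftRel, signRel, Set.mem_ofPred_eq, h1]
  constructor
  · rintro ⟨⟨rfl, h2⟩, -, h3⟩
    exact ⟨h2, rfl, h3⟩
  · rintro ⟨h2, rfl, h3⟩
    exact ⟨⟨rfl, h2⟩, h, h3⟩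

theorem ncard_midpoints_signRel_liftRel (s : Set (X × X)) (H : Matrix X X ℝ) (δ : ZMod 2)
    {p : (X × ZMod 2 × ZMod 2) × (X × ZMod 2 × ZMod 2)} (h : p.1.2.1 ≠ p.2.2.1) :
    (midpoints (signRel H δ) (liftRel s) p).ncard = {z | (z, p.2.1) ∈ s}.ncard := by
  rw [← ncard_graph_image _ p.2.2.1 fun z => signExp H p.1.2.1 p.1.1 z + p.1.2.2 + δ]
  congr 1
  ext ⟨z, c, e⟩
  have h1 (f b : ZMod 2) : f = b + e + δ ↔ e = f + b + δ := by revert f b e δ; decide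
  simp only [midpoints, liftRel, signRel, Set.mem_ofPred_eq, h1]
  constructor
  · rintro ⟨⟨-, h3⟩, rfl, h2⟩
    exact ⟨h2, rfl, h3⟩
  · rintro ⟨h2, rfl, h3⟩
    exact ⟨⟨h, h3⟩, rfl, h2⟩

theorem ncard_midpoints_signRel_signRel (H : Matrix X X ℝ) (δ ε : ZMod 2)
    {p : (X × ZMod 2 × ZMod 2) × (X × ZMod 2 × ZMod 2)} (h : p.1.2.1 = p.2.2.1) :
    (midpoints (signRel H δ) (signRel H ε) p).ncard =
      {z | signExp H p.1.2.1 p.1.1 z + signExp H p.1.2.1 p.2.1 z =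
        p.1.2.2 + p.2.2.2 + δ + ε}.ncard := by
  rw [← ncard_graph_image _ (p.1.2.1 + 1) fun z => signExp H p.1.2.1 p.1.1 z + p.1.2.2 + δ]
  obtain ⟨⟨x, a, b⟩, ⟨y, c, d⟩⟩ := p
  obtain rfl : a = c := h
  congr 1
  ext ⟨z, c, e⟩
  have h1 (f g b d e : ZMod 2) : f = b + e + δ ∧ g = e + d + ε ↔
      f + g = b + d + δ + ε ∧ e = f + b + δ := by
    revert f g b d e δ ε; decide
  simp only [midpoints, signRel, Set.mem_ofPred_eq]
  constructor
  · rintro ⟨⟨h2, h3⟩, h4, h5⟩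
    rw [signExp_swap H h4] at h5
    obtain ⟨h6, h7⟩ := (h1 _ _ _ _ _).1 ⟨h3, h5⟩
    exact ⟨h6, ZMod.two_eq_of_ne h4 (ZMod.two_add_one_ne a), h7⟩
  · rintro ⟨h2, rfl, h3⟩
    obtain ⟨h6, h7⟩ := (h1 _ _ _ _ _).2 ⟨h2, h3⟩
    have h4 := ZMod.two_add_one_ne a
    exact ⟨⟨h4.symm, h6⟩, h4, by rw [signExp_swap H h4, h7]⟩

end Midpoints

theorem SH_isAssocScheme {X : Type*} [Fintype X] [DecidableEq X]
    (S : Set (Set (X × X))) (hS : IsAssocScheme S)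
    (H : Matrix X X ℝ) (hH : IsHadamard H) :
    IsAssocScheme (SH S H) := by
  classical
  have hpart := hH.existsUnique_mem_SH hS
  refine ⟨hpart, hH.mem_SH_iff.2 (.inl ⟨0, diagRel_zero.symm⟩),
    fun s hs => hH.swap_mem_SH hS hs, fun s hs t ht u hu p hp q hq => ?_⟩
  change (midpoints s t p).ncard = (midpoints s t q).ncard
  have hcases := hH.same_fibre_cases hS hu hp hq
  rcases hH.mem_SH_iff.1 hs with ⟨δ, rfl⟩ | ⟨s, hs', -, rfl⟩ | ⟨δ, rfl⟩
  · obtain ⟨u', hu', h⟩ := hH.exists_shift_left δ hu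
    simp only [ncard_midpoints_diagRel_left,
      IsAssocScheme.mem_iff_mem hpart ht hu' (h p hp) (h q hq)]
  all_goals rcases hH.mem_SH_iff.1 ht with ⟨ε, rfl⟩ | ⟨t, ht', -, rfl⟩ | ⟨ε, rfl⟩
  case inr.inl.inl | inr.inr.inl =>
    obtain ⟨u', hu', h⟩ := hH.exists_shift_right ε hu
    simp only [ncard_midpoints_diagRel_right,
      IsAssocScheme.mem_iff_mem hpart hs hu' (h p hp) (h q hq)]
  · rcases hcases with ⟨h1, h2⟩ | ⟨h1, h2, ⟨v, hv, hpv, hqv⟩, -⟩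
    · rw [midpoints_liftRel_liftRel_of_ne _ _ h1, midpoints_liftRel_liftRel_of_ne _ _ h2]
    · rw [ncard_midpoints_liftRel_liftRel _ _ h1, ncard_midpoints_liftRel_liftRel _ _ h2]
      exact congrArg (· * _) (hS.2.2.2 s hs' t ht' v hv _ hpv _ hqv)
  · rcases hcases with ⟨h1, h2⟩ | ⟨h1, h2, -⟩
    · rw [ncard_midpoints_liftRel_signRel _ _ _ h1, ncard_midpoints_liftRel_signRel _ _ _ h2]
      exact hS.ncard_right hs' _ _
    · rw [midpoints_liftRel_signRel_of_eq _ _ _ h1, midpoints_liftRel_signRel_of_eq _ _ _ h2]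
  · rcases hcases with ⟨h1, h2⟩ | ⟨h1, h2, -⟩
    · rw [ncard_midpoints_signRel_liftRel _ _ _ h1, ncard_midpoints_signRel_liftRel _ _ _ h2]
      exact hS.ncard_left ht' _ _
    · rw [midpoints_signRel_liftRel_of_eq _ _ _ h1, midpoints_signRel_liftRel_of_eq _ _ _ h2]
  · rcases hcases with ⟨h1, h2⟩ | ⟨h1, h2, -, ⟨h3, h4⟩ | ⟨h3, h4, h5⟩⟩
    · rw [midpoints_signRel_signRel_of_ne _ _ _ h1, midpoints_signRel_signRel_of_ne _ _ _ h2]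
    · rw [ncard_midpoints_signRel_signRel _ _ _ h1, ncard_midpoints_signRel_signRel _ _ _ h2]
      have h6 := hH.two_mul_ncard_signExp_add p.1.2.1 h3 (p.1.2.2 + p.2.2.2 + δ + ε)
      have h7 := hH.two_mul_ncard_signExp_add q.1.2.1 h4 (q.1.2.2 + q.2.2.2 + δ + ε)
      lia
    · rw [ncard_midpoints_signRel_signRel _ _ _ h1, ncard_midpoints_signRel_signRel _ _ _ h2]
      simp only [h3, h4, h5, ZMod.two_add_self]
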